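/- arXiv:2601.22371 — 2 statements merged into one kernel-verified Lean document; each statement's English description precedes it below -/
import Mathlib

section
/- Let (Ω, 𝓕, P) be a probability space, r : Ω → ℝ a random variable with r and r² integrable, and 𝔪, 𝔥 ⊆ 𝓕 sub-σ-algebras. Define the conditional variance Var(r ∣ 𝔤) = E[r² ∣ 𝔤] − (E[r ∣ 𝔤])² for a sub-σ-algebra 𝔤. If the conditional variances differ on a set of positive probability, i.e. P(Var(r ∣ 𝔪 ⊔ 𝔥) ≠ Var(r ∣ 𝔪)) > 0, then σ(r) is not conditionally independent of 𝔥 given 𝔪. -/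
open MeasureTheory ProbabilityTheory

lemma MeasurableSpace.sup_eq_generateFrom_image2_inter {Ω : Type*} (m₁ m₂ : MeasurableSpace Ω) :
    m₁ ⊔ m₂ = MeasurableSpace.generateFrom
      (Set.image2 (· ∩ ·) {s | MeasurableSet[m₁] s} {s | MeasurableSet[m₂] s}) := by
  apply le_antisymm
  · refine sup_le (fun s hs => ?_) (fun s hs => ?_)
    · exact MeasurableSpace.measurableSet_generateFrom
        ⟨s, hs, Set.univ, MeasurableSet.univ, Set.inter_univ s⟩
    · exact MeasurableSpace.measurableSet_generateFrom
        ⟨Set.univ, MeasurableSet.univ, s, hs, Set.univ_inter s⟩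
  · refine MeasurableSpace.generateFrom_le ?_
    rintro _ ⟨s, hs, t, ht, rfl⟩
    exact MeasurableSet.inter ((le_sup_left : m₁ ≤ m₁ ⊔ m₂) s hs)
      ((le_sup_right : m₂ ≤ m₁ ⊔ m₂) t ht)

lemma isPiSystem_image2_inter_measurableSet {Ω : Type*} (m₁ m₂ : MeasurableSpace Ω) :
    IsPiSystem (Set.image2 (· ∩ ·) {s | MeasurableSet[m₁] s} {s | MeasurableSet[m₂] s}) := by
  rintro _ ⟨s, hs, t, ht, rfl⟩ _ ⟨s', hs', t', ht', rfl⟩ -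
  exact ⟨s ∩ s', MeasurableSet.inter hs hs', t ∩ t', MeasurableSet.inter ht ht',
    Set.inter_inter_inter_comm s s' t t'⟩

/-- Two integrable functions with equal integrals over all `A ∩ B`, `A ∈ m₁`, `B ∈ m₂`, have equal
integrals over every set of `m₁ ⊔ m₂`. -/
lemma setIntegral_eq_of_measurableSet_sup {Ω : Type*} {m₁ m₂ mΩ : MeasurableSpace Ω}
    {μ : Measure Ω} (hm₁ : m₁ ≤ mΩ) (hm₂ : m₂ ≤ mΩ) {f g : Ω → ℝ}
    (hf : Integrable f μ) (hg : Integrable g μ)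
    (hfg : ∀ A B, MeasurableSet[m₁] A → MeasurableSet[m₂] B →
      ∫ ω in A ∩ B, f ω ∂μ = ∫ ω in A ∩ B, g ω ∂μ)
    {s : Set Ω} (hs : MeasurableSet[m₁ ⊔ m₂] s) :
    ∫ ω in s, f ω ∂μ = ∫ ω in s, g ω ∂μ := by
  have hle : m₁ ⊔ m₂ ≤ mΩ := sup_le hm₁ hm₂
  induction s, hs using MeasurableSpace.induction_on_inter
    (MeasurableSpace.sup_eq_generateFrom_image2_inter m₁ m₂)
    (isPiSystem_image2_inter_measurableSet m₁ m₂) with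
  | empty => simp
  | basic t ht =>
    obtain ⟨A, hA, B, hB, rfl⟩ := ht
    exact hfg A B hA hB
  | compl t ht ih =>
    have huniv := hfg Set.univ Set.univ MeasurableSet.univ MeasurableSet.univ
    simp only [Set.inter_univ, setIntegral_univ] at huniv
    rw [setIntegral_compl (hle t ht) hf, setIntegral_compl (hle t ht) hg, ih, huniv]
  | iUnion F hF hFm ih =>
    rw [integral_iUnion (fun i => hle _ (hFm i)) hF hf.integrableOn,
      integral_iUnion (fun i => hle _ (hFm i)) hF hg.integrableOn]
    exact tsum_congr ih

lemma ProbabilityTheory.CondIndep.comap_congr_left {Ω β : Type*} [MeasurableSpace β]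
    {m h mΩ : MeasurableSpace Ω} [StandardBorelSpace Ω] {μ : Measure Ω} [IsFiniteMeasure μ]
    {hm : m ≤ mΩ} {f g : Ω → β}
    (hind : CondIndep m (MeasurableSpace.comap f inferInstance) h hm μ) (hfg : f =ᵐ[μ] g) :
    CondIndep m (MeasurableSpace.comap g inferInstance) h hm μ := by
  have hae : ∀ᵐ ω ∂(μ.trim hm), f =ᵐ[condExpKernel μ m ω] g := by
    refine Measure.ae_ae_of_ae_comp (p := fun ω => f ω = g ω) ?_
    rwa [condExpKernel_comp_trim hm]
  rintro _ t ⟨B, hB, rfl⟩ ht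
  filter_upwards [hind _ t ⟨B, hB, rfl⟩ ht, hae] with ω hω hfgω
  have hpre : f ⁻¹' B =ᵐ[condExpKernel μ m ω] g ⁻¹' B := hfgω.preimage B
  have hinter : (f ⁻¹' B ∩ t : Set Ω) =ᵐ[condExpKernel μ m ω] (g ⁻¹' B ∩ t : Set Ω) :=
    hpre.inter (Filter.EventuallyEq.refl _ t)
  rwa [← measure_congr hpre, ← measure_congr hinter]

section CondIndep

variable {Ω : Type*} {m m₁ h mΩ : MeasurableSpace Ω} [StandardBorelSpace Ω] {μ : Measure Ω}
  [IsFiniteMeasure μ] {hm : m ≤ mΩ}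

lemma ProbabilityTheory.CondIndep.condExp_indicator_sup (hm₁ : m₁ ≤ mΩ) (hh : h ≤ mΩ)
    (hind : CondIndep m m₁ h hm μ) {s : Set Ω} (hs : MeasurableSet[m₁] s) :
    μ⟦s | m ⊔ h⟧ =ᵐ[μ] μ⟦s | m⟧ := by
  have hind' := (condIndep_iff m m₁ h hm hm₁ hh μ).1 hind
  have hint : ∀ t, MeasurableSet t → Integrable (t.indicator fun _ => (1 : ℝ)) μ :=
    fun t ht => (integrable_const 1).indicator ht
  refine (ae_eq_condExp_of_forall_setIntegral_eq (sup_le hm hh) (hint s (hm₁ s hs))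
    (fun _ _ _ => integrable_condExp.integrableOn) (fun u hu _ => ?_)
    (stronglyMeasurable_condExp.mono (le_sup_left : m ≤ m ⊔ h)).aestronglyMeasurable).symm
  refine setIntegral_eq_of_measurableSet_sup hm hh integrable_condExp (hint s (hm₁ s hs))
    (fun A B hA hB => ?_) hu
  have hB' := hh B hB
  have hs' := hm₁ s hs
  have hmul : μ⟦s | m⟧ * (B.indicator fun _ => (1 : ℝ)) = B.indicator (μ⟦s | m⟧) := by
    ext ω
    by_cases hω : ω ∈ B <;> simp [hω]
  have hpull : μ[B.indicator (μ⟦s | m⟧) | m] =ᵐ[μ] μ⟦s | m⟧ * μ⟦B | m⟧ := by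
    rw [← hmul]
    refine condExp_mul_of_stronglyMeasurable_left stronglyMeasurable_condExp ?_ (hint B hB')
    rw [hmul]
    exact integrable_condExp.indicator hB'
  calc ∫ ω in A ∩ B, (μ⟦s | m⟧) ω ∂μ
      = ∫ ω in A, B.indicator (μ⟦s | m⟧) ω ∂μ := (setIntegral_indicator hB').symm
    _ = ∫ ω in A, (μ[B.indicator (μ⟦s | m⟧) | m]) ω ∂μ :=
      (setIntegral_condExp hm (integrable_condExp.indicator hB') hA).symm
    _ = ∫ ω in A, (μ⟦s ∩ B | m⟧) ω ∂μ :=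
      integral_congr_ae (ae_restrict_of_ae (hpull.trans (hind' s B hs hB).symm))
    _ = ∫ ω in A, (s ∩ B).indicator (fun _ => (1 : ℝ)) ω ∂μ :=
      setIntegral_condExp hm (hint _ (hs'.inter hB')) hA
    _ = ∫ ω in A ∩ B, s.indicator (fun _ => (1 : ℝ)) ω ∂μ := by
      rw [Set.inter_comm s B, ← Set.indicator_indicator, setIntegral_indicator hB']

/-- If `m₁` and `h` are conditionally independent given `m`, adjoining `h` to `m` does not change
the conditional expectation of an `m₁`-measurable function. -/
lemma ProbabilityTheory.CondIndep.condExp_sup_eq (hm₁ : m₁ ≤ mΩ) (hh : h ≤ mΩ)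
    (hind : CondIndep m m₁ h hm μ) {f : Ω → ℝ} (hf : AEStronglyMeasurable[m₁] f μ) :
    μ[f | m ⊔ h] =ᵐ[μ] μ[f | m] := by
  by_cases hfint : Integrable f μ
  swap
  · rw [condExp_of_not_integrable hfint, condExp_of_not_integrable hfint]
  refine MemLp.induction_stronglyMeasurable hm₁ ENNReal.one_ne_top
    (fun f => μ[f | m ⊔ h] =ᵐ[μ] μ[f | m]) ?_ ?_ ?_ ?_ (memLp_one_iff_integrable.2 hfint) hf
  · intro c s hs _
    have hc : (s.indicator fun _ => c) = c • s.indicator fun _ => (1 : ℝ) := by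
      ext ω
      by_cases hω : ω ∈ s <;> simp [hω]
    rw [hc]
    exact (condExp_smul c _ _).trans
      (((hind.condExp_indicator_sup hm₁ hh hs).const_smul c).trans (condExp_smul c _ _).symm)
  · intro u v _ hu hv _ _ hu_eq hv_eq
    rw [memLp_one_iff_integrable] at hu hv
    exact (condExp_add hu hv _).trans ((hu_eq.add hv_eq).trans (condExp_add hu hv _).symm)
  · have hclosed : IsClosed {f : lpMeas ℝ ℝ m₁ 1 μ |
        condExpL1CLM ℝ (sup_le hm hh) μ (f : Lp ℝ 1 μ) = condExpL1CLM ℝ hm μ (f : Lp ℝ 1 μ)} :=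
      isClosed_eq (by fun_prop) (by fun_prop)
    convert hclosed using 1
    ext f
    have key : ∀ {m' : MeasurableSpace Ω} (hm' : m' ≤ mΩ),
        μ[((f : Lp ℝ 1 μ) : Ω → ℝ) | m'] =ᵐ[μ] condExpL1CLM ℝ hm' μ (f : Lp ℝ 1 μ) := by
      intro m' hm'
      have := condExp_ae_eq_condExpL1CLM hm' (L1.integrable_coeFn (f : Lp ℝ 1 μ))
      rwa [Integrable.toL1_coeFn] at this
    constructor
    · intro hfe
      exact Lp.ext ((key _).symm.trans (Filter.EventuallyEq.trans hfe (key _)))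
    · intro hfe
      refine (key (sup_le hm hh)).trans (Filter.EventuallyEq.trans ?_ (key hm).symm)
      rw [Set.mem_ofPred_eq.mp hfe]
  · intro u v huv _ hu_eq
    exact (condExp_congr_ae huv.symm).trans (hu_eq.trans (condExp_congr_ae huv))

end CondIndep

/-- **Variance–residual coupling contradicts conditional independence.** If the conditional
variances `Var(r | m ⊔ h)` and `Var(r | m)` differ on a set of positive probability, then
`σ(r)` is not conditionally independent of `h` given `m`. -/
theorem not_condIndep_of_condVar_ne {Ω : Type*} [mΩ : MeasurableSpace Ω]
    [StandardBorelSpace Ω]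
    (μ : Measure Ω) [IsProbabilityMeasure μ]
    (r : Ω → ℝ) (hr : Integrable r μ) (hr2 : Integrable (fun ω => (r ω) ^ 2) μ)
    (m h : MeasurableSpace Ω) (hm : m ≤ mΩ) (hh : h ≤ mΩ)
    (hvar : 0 < μ {ω |
        (μ[fun ω => (r ω) ^ 2|m ⊔ h]) ω - ((μ[r|m ⊔ h]) ω) ^ 2
        ≠ (μ[fun ω => (r ω) ^ 2|m]) ω - ((μ[r|m]) ω) ^ 2}) :
    ¬ CondIndep m (MeasurableSpace.comap r inferInstance) h hm μ := by
  intro hind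
  let g := hr.1.mk r
  have hrg : r =ᵐ[μ] g := hr.1.ae_eq_mk
  have hgm : Measurable[mΩ] g := hr.1.stronglyMeasurable_mk.measurable
  have hind' := hind.comap_congr_left hrg
  have hgm₁ : Measurable[MeasurableSpace.comap g inferInstance] g := comap_measurable g
  have key : ∀ φ : ℝ → ℝ, Measurable φ →
      μ[fun ω => φ (r ω)|m ⊔ h] =ᵐ[μ] μ[fun ω => φ (r ω)|m] := fun φ hφ =>
    hind'.condExp_sup_eq hgm.comap_le hh ⟨fun ω => φ (g ω),
      (hφ.comp hgm₁).stronglyMeasurable, hrg.fun_comp φ⟩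
  refine hvar.ne' (ae_iff.1 ?_)
  filter_upwards [key id measurable_id, key (· ^ 2) (measurable_id.pow_const 2)] with ω h₁ h₂
  simp only [id] at h₁
  rw [h₁, h₂]
end

section
/- Let X be an integrable real random variable with cumulative distribution function F(y) = P(X ≤ y) and quantile function Q(τ) = inf{y ∈ ℝ : F(y) ≥ τ}. Define the integrated distribution function J(x) = E[max(x − X, 0)] and the integrated quantile function K(u) = ∫_0^u Q(s) ds. Then for every u ∈ (0,1), K(u) is the Legendre–Fenchel conjugate of J evaluated at u: ∫_0^u Q(s) ds = sup_{x ∈ ℝ} (u·x − E[max(x − X, 0)]). -/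
open MeasureTheory

/-- The quantile function of a Borel (probability) measure `μ` on `ℝ`:
`Q(τ) = inf {y : F(y) ≥ τ}` where `F(y) = μ((-∞, y])` is the CDF. -/
noncomputable def quantile (μ : Measure ℝ) (τ : ℝ) : ℝ :=
  sInf {y : ℝ | τ ≤ (μ (Set.Iic y)).toReal}

open Set

/-- The Galois connection between the quantile function and the distribution function. -/
lemma quantile_le_iff (μ : Measure ℝ) [IsProbabilityMeasure μ] {τ : ℝ} (hτ : τ ∈ Ioo (0 : ℝ) 1)
    (y : ℝ) : quantile μ τ ≤ y ↔ τ ≤ μ.real (Iic y) := by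
  have hmono := ProbabilityTheory.monotone_cdf μ
  simp only [← ProbabilityTheory.cdf_eq_real]
  have hq : quantile μ τ = sInf {z : ℝ | τ ≤ ProbabilityTheory.cdf μ z} := by
    simp only [quantile, ProbabilityTheory.cdf_eq_real, measureReal_def]
  rw [hq]
  have hbdd : BddBelow {z : ℝ | τ ≤ ProbabilityTheory.cdf μ z} := by
    obtain ⟨a, ha⟩ :=
      ((ProbabilityTheory.tendsto_cdf_atBot μ).eventually (gt_mem_nhds hτ.1)).exists
    exact ⟨a, fun z hz => le_of_not_gt fun h => absurd (hz.trans (hmono h.le)) (not_le.2 ha)⟩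
  have hne : {z : ℝ | τ ≤ ProbabilityTheory.cdf μ z}.Nonempty := by
    obtain ⟨a, ha⟩ :=
      ((ProbabilityTheory.tendsto_cdf_atTop μ).eventually (lt_mem_nhds hτ.2)).exists
    exact ⟨a, ha.le⟩
  refine ⟨fun h => ?_, fun h => csInf_le hbdd h⟩
  have hright : Filter.Tendsto (ProbabilityTheory.cdf μ) (nhdsWithin y (Ioi y))
      (nhds (ProbabilityTheory.cdf μ y)) :=
    ((ProbabilityTheory.cdf μ).right_continuous y).tendsto.mono_left
      (nhdsWithin_mono y Ioi_subset_Ici_self)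
  refine ge_of_tendsto hright ?_
  filter_upwards [self_mem_nhdsWithin] with z hz
  obtain ⟨w, hw, hwz⟩ := exists_lt_of_csInf_lt hne (lt_of_le_of_lt h hz)
  exact le_trans hw (hmono hwz.le)

lemma monotoneOn_quantile (μ : Measure ℝ) [IsProbabilityMeasure μ] :
    MonotoneOn (quantile μ) (Ioo 0 1) := fun _ hs _ ht hst =>
  (quantile_le_iff μ hs _).2 (hst.trans ((quantile_le_iff μ ht _).1 le_rfl))

lemma aemeasurable_quantile (μ : Measure ℝ) [IsProbabilityMeasure μ] :
    AEMeasurable (quantile μ) (volume.restrict (Ioo 0 1)) :=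
  aemeasurable_restrict_of_monotoneOn measurableSet_Ioo (monotoneOn_quantile μ)

/-- The quantile function pushes the uniform distribution on `(0, 1)` forward to `μ`. -/
lemma map_quantile (μ : Measure ℝ) [IsProbabilityMeasure μ] :
    (volume.restrict (Ioo (0 : ℝ) 1)).map (quantile μ) = μ := by
  refine (Measure.ext_of_Iic _ _ fun y => ?_).symm
  rw [Measure.map_apply_of_aemeasurable (aemeasurable_quantile μ) measurableSet_Iic,
    Measure.restrict_apply' measurableSet_Ioo]
  have hset : quantile μ ⁻¹' Iic y ∩ Ioo 0 1 = Iic (μ.real (Iic y)) ∩ Ioo 0 1 := by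
    ext s
    simp only [mem_inter_iff, mem_preimage, mem_Iic]
    exact and_congr_left fun hs => quantile_le_iff μ hs y
  have hle : μ.real (Iic y) ≤ 1 := measureReal_le_one
  have hvol : volume (Iic (μ.real (Iic y)) ∩ Ioo 0 1) = volume (Ioc 0 (μ.real (Iic y))) := by
    rw [measure_congr ((Filter.EventuallyEq.refl _ _).inter Ioo_ae_eq_Ioc), inter_comm,
      Ioc_inter_Iic, min_eq_right hle]
  rw [hset, hvol, Real.volume_Ioc, sub_zero, ofReal_measureReal]

/-- **Fenchel conjugacy of the integrated distribution and quantile functions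
(Gushchin–Borzykh).** For an integrable real random variable `X` with integrated distribution
function `J(x) = E[max(x - X, 0)]` and quantile function `Q`, the integrated quantile function
`K(u) = ∫_0^u Q(s) ds` satisfies `K(u) = sup_x (u·x - J(x))` for every `u ∈ (0,1)`. -/
theorem integratedQuantile_eq_fenchel_conjugate {Ω : Type*} [MeasurableSpace Ω]
    (P : Measure Ω) [IsProbabilityMeasure P]
    (X : Ω → ℝ) (hX : Integrable X P)
    (u : ℝ) (hu : u ∈ Set.Ioo (0 : ℝ) 1) :
    ∫ s in (0 : ℝ)..u, quantile (Measure.map X P) s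
      = ⨆ x : ℝ, (u * x - ∫ ω, max (x - X ω) 0 ∂P) := by
  have hXm := hX.aemeasurable
  have hprob : IsProbabilityMeasure (Measure.map X P) := Measure.isProbabilityMeasure_map hXm
  have hid : Integrable id (Measure.map X P) :=
    (integrable_map_measure aestronglyMeasurable_id hXm).2 hX
  have hQm := aemeasurable_quantile (Measure.map X P)
  have hmono := monotoneOn_quantile (Measure.map X P)
  have hmap := map_quantile (Measure.map X P)
  have hJ : ∀ x : ℝ, ∫ ω, max (x - X ω) 0 ∂P
      = ∫ s in Ioo 0 1, max (x - quantile (Measure.map X P) s) 0 := by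
    intro x
    have hc : Continuous fun y : ℝ => max (x - y) 0 := by fun_prop
    rw [← integral_map hXm (f := fun y => max (x - y) 0) hc.aestronglyMeasurable,
      ← integral_map hQm (f := fun y => max (x - y) 0) hc.aestronglyMeasurable, hmap]
  have hQ : IntegrableOn (quantile (Measure.map X P)) (Ioo 0 1) := by
    rw [← hmap] at hid
    exact (integrable_map_measure aestronglyMeasurable_id hQm).1 hid
  generalize quantile (Measure.map X P) = Q at hQ hJ hmono ⊢
  have hsub : Ioc 0 u ⊆ Ioo 0 1 := fun s hs => ⟨hs.1, hs.2.trans_lt hu.2⟩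
  have hlin : ∀ x, ∫ s in Ioc 0 u, (x - Q s) = u * x - ∫ s in Ioc 0 u, Q s := by
    intro x
    rw [integral_sub (integrable_const x) (hQ.mono_set hsub)]
    simp [hu.1.le]
  have hpos : ∀ x, IntegrableOn (fun s => max (x - Q s) 0) (Ioo 0 1) := fun x =>
    ((integrable_const x).sub hQ).pos_part
  rw [intervalIntegral.integral_of_le hu.1.le]
  simp only [hJ]
  refine (IsGreatest.csSup_eq (s := range _) ⟨⟨Q u, ?_⟩, ?_⟩).symm
  · have heq : ∫ s in Ioo 0 1, max (Q u - Q s) 0 = ∫ s in Ioc 0 u, (Q u - Q s) := by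
      rw [setIntegral_eq_of_subset_of_forall_sdiff_eq_zero measurableSet_Ioo hsub]
      · refine setIntegral_congr_fun measurableSet_Ioc fun s hs => ?_
        exact max_eq_left (sub_nonneg.2 (hmono (hsub hs) hu hs.2))
      · rintro s ⟨hs, hsu⟩
        have hus : u ≤ s := le_of_not_ge fun h => hsu ⟨hs.1, h⟩
        exact max_eq_right (sub_nonpos.2 (hmono hu hs hus))
    simp only [heq, hlin]
    ring
  · rintro _ ⟨x, rfl⟩
    have hle : ∫ s in Ioc 0 u, (x - Q s) ≤ ∫ s in Ioo 0 1, max (x - Q s) 0 :=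
      (setIntegral_mono ((integrable_const x).sub (hQ.mono_set hsub)) ((hpos x).mono_set hsub)
        fun s => le_max_left _ _).trans
      (setIntegral_mono_set (hpos x) (Filter.Eventually.of_forall fun s => le_max_right _ _)
        hsub.eventuallyLE)
    rw [hlin] at hle
    dsimp only
    linarith
end
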